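/- arXiv:math/0507488 — 2 statements merged into one kernel-verified Lean document; each statement's English description precedes it below -/
import Mathlib

section
/- Let d, n, r be integers with 2 ≤ r ≤ d and r−1 ≤ min(d,n). Let B be a binary form of order n and let A₁,…,A_r be binary forms of order d over ℂ. Then Γ_{r−1}(B; A₁,…,A_r) = (−1)^{r−1} · B · W(A₁,…,A_r). -/
open MvPolynomial Finset

/-- The `k`-th transvectant of binary forms `E, F` of orders `e, f`. -/
noncomputable def transvectant (e f k : ℕ) (E F : MvPolynomial (Fin 2) ℂ) :
    MvPolynomial (Fin 2) ℂ :=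
  ((((e - k).factorial * (f - k).factorial : ℕ) : ℂ) /
      ((e.factorial * f.factorial : ℕ) : ℂ)) •
    ∑ i ∈ Finset.range (k + 1),
      ((-1 : ℂ) ^ i * (k.choose i : ℂ)) •
        ((⇑(pderiv (0 : Fin 2)))^[k - i] ((⇑(pderiv (1 : Fin 2)))^[i] E) *
          (⇑(pderiv (0 : Fin 2)))^[i] ((⇑(pderiv (1 : Fin 2)))^[k - i] F))

/-- The Wronskian of `s` binary forms of order `n`. -/
noncomputable def wronskian (n : ℕ) {s : ℕ} (F : Fin s → MvPolynomial (Fin 2) ℂ) :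
    MvPolynomial (Fin 2) ℂ :=
  (((n - s + 1).factorial : ℂ) / (n.factorial : ℂ)) ^ s •
    Matrix.det (Matrix.of fun i j : Fin s =>
      (⇑(pderiv (0 : Fin 2)))^[s - 1 - (j : ℕ)] ((⇑(pderiv (1 : Fin 2)))^[(j : ℕ)] (F i)))

/-- Remove the `i`-th member from a family indexed by `Fin r`. -/
def removeIdx {α : Sort*} {r : ℕ} (A : Fin r → α) (i : Fin r) : Fin (r - 1) → α :=
  fun j => A (Fin.cast (Nat.succ_pred_eq_of_pos i.pos)
    (Fin.succAbove (Fin.cast (Nat.succ_pred_eq_of_pos i.pos).symm i) j))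

/-- `Γ_p(B; A₁,…,A_r) = Σᵢ (−1)^{i+1} (B,Aᵢ)_p · W(A₁,…,Âᵢ,…,A_r)`,
where `B` has order `n` and the `Aᵢ` have order `d`. -/
noncomputable def gammaTransvectant (d n p : ℕ) {r : ℕ}
    (B : MvPolynomial (Fin 2) ℂ) (A : Fin r → MvPolynomial (Fin 2) ℂ) :
    MvPolynomial (Fin 2) ℂ :=
  ∑ i : Fin r, (-1 : ℂ) ^ (i : ℕ) •
    (transvectant n d p B (A i) * wronskian d (removeIdx A i))

/-- The index set `𝒩_r = {q : 0 ≤ q ≤ r, q ≠ 1}`. -/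
def Nset (r : ℕ) : Finset ℕ := (Finset.range (r + 1)).filter (· ≠ 1)

/-- A Wronskian-combinant collection for binary forms `A₁,…,A_r` of order `d`:
forms `C_q` of order `r(d−r+1)−2q` for `q ∈ 𝒩_r` with
`W(A₁,…,A_r,F) = Σ_q (C_q,F)_{r−q}` for all forms `F` of order `d`. -/
def IsWronskianCombinantCollection (d r : ℕ)
    (A : Fin r → MvPolynomial (Fin 2) ℂ) (C : ℕ → MvPolynomial (Fin 2) ℂ) : Prop :=
  (∀ q ∈ Nset r, (C q).IsHomogeneous (r * (d - r + 1) - 2 * q)) ∧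
  ∀ F : MvPolynomial (Fin 2) ℂ, F.IsHomogeneous d →
    wronskian d (Fin.snoc A F) =
      ∑ q ∈ Nset r, transvectant (r * (d - r + 1) - 2 * q) d (r - q) (C q) F


/-- Determinant of the matrix with first column `v` and remaining columns `x eⱼ + y eⱼ₊₁`. -/
theorem det_cons_bidiagonal {R : Type*} [CommRing R] (x y : R) (k : ℕ) (v : Fin (k + 1) → R) :
    Matrix.det (Matrix.of fun i : Fin (k + 1) => (Fin.cons (v i) (fun j : Fin k =>
      (if i = j.castSucc then x else 0) + (if i = j.succ then y else 0)) : Fin (k + 1) → R)) =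
    ∑ l : Fin (k + 1), (-1) ^ (l : ℕ) * v l * x ^ (l : ℕ) * y ^ (k - (l : ℕ)) := by
  induction k with
  | zero => simp
  | succ k ih =>
    rw [Matrix.det_succ_row_zero, Fin.sum_univ_succ, Fin.sum_univ_succ, Finset.sum_eq_zero]
    · rw [Fin.sum_univ_succ, add_zero]
      congr 1
      · rw [Matrix.det_of_isUpperTriangular]
        · have hd (i : Fin (k + 1)) : i.succ ≠ i.castSucc := by simp [Fin.ext_iff]
          simp [hd]
        · intro i j hij
          have hij' : (j : ℕ) < i := hij
          simp [Fin.ext_iff]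
          grind
      · have hsub : (Matrix.of fun i : Fin (k + 2) => (Fin.cons (v i) (fun j : Fin (k + 1) =>
            (if i = j.castSucc then x else 0) + (if i = j.succ then y else 0)) :
              Fin (k + 2) → R)).submatrix Fin.succ (Fin.succAbove (Fin.succ 0)) =
            Matrix.of fun i : Fin (k + 1) => (Fin.cons (v i.succ) (fun j : Fin k =>
              (if i = j.castSucc then x else 0) + (if i = j.succ then y else 0)) :
                Fin (k + 1) → R) := by
          ext i j
          refine Fin.cases ?_ (fun j => ?_) j
          · simp
          · simp [Fin.ext_iff]
        rw [hsub, ih (fun i => v i.succ), Finset.mul_sum]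
        refine Finset.sum_congr rfl fun l _ => ?_
        simp [pow_succ]
        ring
    · intro j _
      have h0 : (0 : Fin (k + 2)) ≠ j.succ.castSucc := by simp [Fin.ext_iff]
      have h1 : (0 : Fin (k + 2)) ≠ j.succ.succ := by simp [Fin.ext_iff]
      simp only [Matrix.of_apply, Fin.cons_succ, if_neg h0, if_neg h1]
      simp

/-- Euler's identity for a binary form. -/
theorem MvPolynomial.IsHomogeneous.euler_binary {n : ℕ} {B : MvPolynomial (Fin 2) ℂ}
    (hB : B.IsHomogeneous n) :
    X 0 * pderiv 0 B + X 1 * pderiv 1 B = (n : MvPolynomial (Fin 2) ℂ) * B := by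
  simpa using hB.sum_X_mul_pderiv

/-- Partial derivatives commute. -/
theorem pderiv_commute {σ R : Type*} [CommRing R] (i j : σ) :
    Function.Commute (⇑(pderiv (R := R) i)) (⇑(pderiv (R := R) j)) := by
  classical
  intro p
  have h : ⁅pderiv (R := R) i, pderiv (R := R) j⁆ = 0 := by
    refine derivation_ext fun l => ?_
    rw [Derivation.commutator_apply]
    simp [Pi.single_apply, apply_ite]
  rw [← sub_eq_zero, ← Derivation.commutator_apply, h, Derivation.zero_apply]

theorem MvPolynomial.IsHomogeneous.iterate_pderiv {σ R : Type*} [CommSemiring R] {n : ℕ}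
    {B : MvPolynomial σ R} (hB : B.IsHomogeneous n) (i : σ) (k : ℕ) :
    ((⇑(pderiv i))^[k] B).IsHomogeneous (n - k) := by
  induction k with
  | zero => simpa
  | succ k ih =>
    rw [Function.iterate_succ_apply', ← Nat.sub_sub]
    exact ih.pderiv

/-- Euler's identity for the derivatives of order `k` of a binary form. -/
theorem MvPolynomial.IsHomogeneous.euler_binary_iterate {n : ℕ} (k : ℕ) (hk : k ≤ n)
    {B : MvPolynomial (Fin 2) ℂ} (hB : B.IsHomogeneous n) :
    ∑ ij ∈ antidiagonal k, k.choose ij.1 • (X 0 ^ ij.2 * X 1 ^ ij.1 *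
      (⇑(pderiv (0 : Fin 2)))^[ij.2] ((⇑(pderiv (1 : Fin 2)))^[ij.1] B)) =
      (n.descFactorial k : MvPolynomial (Fin 2) ℂ) * B := by
  induction k generalizing n B with
  | zero => simp
  | succ k ih =>
    obtain ⟨n, rfl⟩ : ∃ m, n = m + 1 := ⟨n - 1, by omega⟩
    have h0 := ih (by omega) (hB.pderiv (i := 0))
    have h1 := ih (by omega) (hB.pderiv (i := 1))
    simp only [Nat.add_sub_cancel] at h0 h1
    rw [Finset.sum_antidiagonal_choose_succ_nsmul (fun a b => (X 0 ^ b * X 1 ^ a *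
      (⇑(pderiv (0 : Fin 2)))^[b] ((⇑(pderiv (1 : Fin 2)))^[a] B)))]
    have hR : ((n + 1).descFactorial (k + 1) : MvPolynomial (Fin 2) ℂ) * B =
        X 0 * ((n.descFactorial k : MvPolynomial (Fin 2) ℂ) * pderiv 0 B) +
          X 1 * ((n.descFactorial k : MvPolynomial (Fin 2) ℂ) * pderiv 1 B) := by
      have h := hB.euler_binary
      rw [Nat.succ_descFactorial_succ, Nat.cast_mul]
      linear_combination (-(n.descFactorial k : MvPolynomial (Fin 2) ℂ)) * h
    rw [hR, ← h0, ← h1, Finset.mul_sum, Finset.mul_sum]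
    refine congrArg₂ (· + ·) (Finset.sum_congr rfl fun ij _ => ?_)
      (Finset.sum_congr rfl fun ij hij => ?_)
    · rw [Function.iterate_succ_apply,
        ← ((pderiv_commute (R := ℂ) (0 : Fin 2) 1).iterate_right ij.1).eq B]
      simp only [nsmul_eq_mul]
      ring
    · rw [Function.iterate_succ_apply (pderiv 1),
        Nat.choose_symm_of_eq_add (mem_antidiagonal.1 hij).symm]
      simp only [nsmul_eq_mul]
      ring

/-- Euler's identity applied to a partial derivative of order `p + q` of a binary form. -/
theorem MvPolynomial.IsHomogeneous.euler_binary_pderiv {d : ℕ} {F : MvPolynomial (Fin 2) ℂ}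
    (hF : F.IsHomogeneous d) (p q : ℕ) (hpq : p + q < d) :
    (⇑(pderiv (0 : Fin 2)))^[p] ((⇑(pderiv (1 : Fin 2)))^[q] F) =
      C ((d - (p + q) : ℕ) : ℂ)⁻¹ * X 0 *
        (⇑(pderiv (0 : Fin 2)))^[p + 1] ((⇑(pderiv (1 : Fin 2)))^[q] F) +
      C ((d - (p + q) : ℕ) : ℂ)⁻¹ * X 1 *
        (⇑(pderiv (0 : Fin 2)))^[p] ((⇑(pderiv (1 : Fin 2)))^[q + 1] F) := by
  have h := ((hF.iterate_pderiv 1 q).iterate_pderiv 0 p).euler_binary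
  rw [Nat.sub_sub, Nat.add_comm q p] at h
  rw [Function.iterate_succ_apply', Function.iterate_succ_apply' _ q,
    ← ((pderiv_commute (R := ℂ) (1 : Fin 2) 0).iterate_right p).eq, mul_assoc, mul_assoc,
    ← mul_add, h, ← map_natCast (C (R := ℂ) (σ := Fin 2)), ← mul_assoc, ← map_mul,
    inv_mul_cancel₀, map_one, one_mul]
  exact Nat.cast_ne_zero.2 (by omega)

/-- Laplace expansion along a first column that is a combination of the columns of `M`, when the
remaining columns are `x Mⱼ + y Mⱼ₊₁`. -/
theorem sum_mul_det_removed_row {R : Type*} [CommRing R] (x y : R) (k : ℕ)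
    (M : Matrix (Fin (k + 1)) (Fin (k + 1)) R) (v : Fin (k + 1) → R) :
    ∑ i : Fin (k + 1), (-1) ^ (i : ℕ) * (∑ l, M i l * v l) *
      Matrix.det (Matrix.of fun (a b : Fin k) =>
        x * M (i.succAbove a) b.castSucc + y * M (i.succAbove a) b.succ) =
    M.det * ∑ l : Fin (k + 1), (-1) ^ (l : ℕ) * v l * x ^ (l : ℕ) * y ^ (k - (l : ℕ)) := by
  rw [← det_cons_bidiagonal, ← Matrix.det_mul, Matrix.det_succ_column_zero]
  refine Finset.sum_congr rfl fun i _ => ?_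
  congr 2
  ext a b
  simp [Matrix.mul_apply, mul_add, Finset.sum_add_distrib, mul_comm]

/-- The transvectant as a combination of the derivatives of order `k` of `F`. -/
theorem transvectant_eq_sum_fin (n d k : ℕ) (B F : MvPolynomial (Fin 2) ℂ) :
    transvectant n d k B F =
      C ((((n - k).factorial * (d - k).factorial : ℕ) : ℂ) /
        ((n.factorial * d.factorial : ℕ) : ℂ)) *
      ∑ l : Fin (k + 1),
        (⇑(pderiv (0 : Fin 2)))^[k - (l : ℕ)] ((⇑(pderiv (1 : Fin 2)))^[(l : ℕ)] F) *
          ((-1) ^ (k - (l : ℕ)) * (k.choose l : MvPolynomial (Fin 2) ℂ) *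
            (⇑(pderiv (0 : Fin 2)))^[(l : ℕ)] ((⇑(pderiv (1 : Fin 2)))^[k - (l : ℕ)] B)) := by
  rw [transvectant, ← C_mul', Fin.sum_univ_eq_sum_range (fun l =>
    (⇑(pderiv (0 : Fin 2)))^[k - l] ((⇑(pderiv (1 : Fin 2)))^[l] F) *
      ((-1) ^ (k - l) * (k.choose l : MvPolynomial (Fin 2) ℂ) *
        (⇑(pderiv (0 : Fin 2)))^[l] ((⇑(pderiv (1 : Fin 2)))^[k - l] B))),
    ← Finset.sum_range_reflect]
  congr 1
  refine Finset.sum_congr rfl fun l hl => ?_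
  have hl' : l ≤ k := Nat.lt_succ_iff.1 (Finset.mem_range.1 hl)
  have e : k + 1 - 1 - l = k - l := by omega
  rw [e, Nat.sub_sub_self hl', Nat.choose_symm hl', ← C_mul']
  simp only [map_mul, map_pow, map_neg, map_one, map_natCast]
  ring

theorem MvPolynomial.IsHomogeneous.euler_binary_signed_sum {n k : ℕ} (hk : k ≤ n)
    {B : MvPolynomial (Fin 2) ℂ} (hB : B.IsHomogeneous n) (a : MvPolynomial (Fin 2) ℂ) :
    ∑ l : Fin (k + 1), (-1) ^ (l : ℕ) *
        ((-1) ^ (k - (l : ℕ)) * (k.choose l : MvPolynomial (Fin 2) ℂ) *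
          (⇑(pderiv (0 : Fin 2)))^[(l : ℕ)] ((⇑(pderiv (1 : Fin 2)))^[k - (l : ℕ)] B)) *
        (a * X 0) ^ (l : ℕ) * (a * X 1) ^ (k - (l : ℕ)) =
      (-1) ^ k * a ^ k * (n.descFactorial k : MvPolynomial (Fin 2) ℂ) * B := by
  rw [mul_assoc _ _ B, ← hB.euler_binary_iterate k hk, ← Finset.Nat.sum_antidiagonal_swap,
    Finset.mul_sum, Finset.Nat.sum_antidiagonal_eq_sum_range_succ_mk,
    ← Fin.sum_univ_eq_sum_range]
  refine Finset.sum_congr rfl fun l _ => ?_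
  obtain ⟨l, hl⟩ := l
  obtain ⟨m, rfl⟩ := Nat.exists_eq_add_of_le (Nat.lt_succ_iff.1 hl)
  simp only [Prod.swap, Nat.add_sub_cancel_left, nsmul_eq_mul]
  rw [Nat.choose_symm_add]
  ring

/-- The Wronskian with one form removed, in terms of derivatives of order `k`. -/
theorem wronskian_removeIdx {d k : ℕ} (hk : k + 1 ≤ d)
    {A : Fin (k + 1) → MvPolynomial (Fin 2) ℂ} (hA : ∀ i, (A i).IsHomogeneous d)
    (i : Fin (k + 1)) :
    wronskian d (removeIdx A i) =
      C ((((d - k + 1).factorial : ℂ) / (d.factorial : ℂ)) ^ k) *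
      Matrix.det (Matrix.of fun (a b : Fin k) =>
        C ((d - k + 1 : ℕ) : ℂ)⁻¹ * X 0 * (⇑(pderiv (0 : Fin 2)))^[k - (b.castSucc : ℕ)]
            ((⇑(pderiv (1 : Fin 2)))^[(b.castSucc : ℕ)] (A (i.succAbove a))) +
        C ((d - k + 1 : ℕ) : ℂ)⁻¹ * X 1 * (⇑(pderiv (0 : Fin 2)))^[k - (b.succ : ℕ)]
            ((⇑(pderiv (1 : Fin 2)))^[(b.succ : ℕ)] (A (i.succAbove a)))) := by
  rw [wronskian, ← C_mul']
  change _ * Matrix.det (Matrix.of fun a b : Fin k => (⇑(pderiv (0 : Fin 2)))^[k - 1 - (b : ℕ)]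
    ((⇑(pderiv (1 : Fin 2)))^[(b : ℕ)] (A (i.succAbove a)))) = _
  congr 2
  ext1 a b
  have hb := b.isLt
  have e : d - (k - 1 - (b : ℕ) + b) = d - k + 1 := by omega
  have e1 : k - 1 - (b : ℕ) + 1 = k - b := by omega
  have e2 : k - 1 - (b : ℕ) = k - (b + 1) := by omega
  have h := (hA (i.succAbove a)).euler_binary_pderiv (k - 1 - b) b (by omega)
  rw [e, e1] at h
  simp only [Matrix.of_apply, Fin.val_castSucc, Fin.val_succ, ← e2]
  exact h

/-- for `2 ≤ r ≤ d`, `r-1 ≤ min(d,n)`, a binary form `B` of order `n`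
and binary forms `A₁,...,A_r` of order `d`,
`Γ_{r-1}(B; A₁,...,A_r) = (-1)^(r-1) * B * W(A₁,...,A_r)`. -/
theorem gamma_sub_one_eq (d n r : ℕ) (hr2 : 2 ≤ r) (hrd : r ≤ d)
    (hd : r - 1 ≤ d) (hn : r - 1 ≤ n)
    (B : MvPolynomial (Fin 2) ℂ) (hB : B.IsHomogeneous n)
    (A : Fin r → MvPolynomial (Fin 2) ℂ) (hA : ∀ i, (A i).IsHomogeneous d) :
    gammaTransvectant d n (r - 1) B A = (-1 : ℂ) ^ (r - 1) • (B * wronskian d A) := by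
  obtain ⟨k, rfl⟩ : ∃ k, r = k + 1 := ⟨r - 1, by omega⟩
  simp only [Nat.add_sub_cancel] at hn ⊢
  set a : MvPolynomial (Fin 2) ℂ := C ((d - k + 1 : ℕ) : ℂ)⁻¹ with ha
  have key := sum_mul_det_removed_row (a * X 0) (a * X 1) k
    (Matrix.of fun i j : Fin (k + 1) => (⇑(pderiv (0 : Fin 2)))^[k - (j : ℕ)]
      ((⇑(pderiv (1 : Fin 2)))^[(j : ℕ)] (A i)))
    (fun l => (-1) ^ (k - (l : ℕ)) * (k.choose l : MvPolynomial (Fin 2) ℂ) *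
      (⇑(pderiv (0 : Fin 2)))^[(l : ℕ)] ((⇑(pderiv (1 : Fin 2)))^[k - (l : ℕ)] B))
  rw [hB.euler_binary_signed_sum hn a] at key
  simp only [Matrix.of_apply] at key
  set c : ℂ := (((n - k).factorial * (d - k).factorial : ℕ) : ℂ) /
    ((n.factorial * d.factorial : ℕ) : ℂ) with hc
  set w : ℂ := (((d - k + 1).factorial : ℂ) / (d.factorial : ℂ)) ^ k with hw
  have hconst : c * w * ((d - k + 1 : ℕ) : ℂ)⁻¹ ^ k * (n.descFactorial k : ℂ) =
      (((d - (k + 1) + 1).factorial : ℂ) / (d.factorial : ℂ)) ^ (k + 1) := by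
    have e : d - (k + 1) + 1 = d - k := by omega
    have hn' : ((n - k).factorial : ℂ) * (n.descFactorial k : ℂ) = n.factorial := by
      exact_mod_cast Nat.factorial_mul_descFactorial hn
    have h1 : (n.factorial : ℂ) ≠ 0 := Nat.cast_ne_zero.2 n.factorial_ne_zero
    have h2 : (d.factorial : ℂ) ≠ 0 := Nat.cast_ne_zero.2 d.factorial_ne_zero
    have h3 : ((d - k + 1 : ℕ) : ℂ) ≠ 0 := Nat.cast_ne_zero.2 (by omega)
    rw [hc, hw, e, Nat.factorial_succ, Nat.cast_mul, Nat.cast_mul, Nat.cast_mul, ← hn']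
    rw [← hn'] at h1
    have h4 := left_ne_zero_of_mul h1
    have h5 := right_ne_zero_of_mul h1
    generalize ((d - k + 1 : ℕ) : ℂ) = m at *
    simp only [div_pow, mul_pow, inv_pow, pow_succ]
    field_simp
  calc gammaTransvectant d n k B A
      = C c * C w * ∑ i : Fin (k + 1), (-1) ^ (i : ℕ) * (∑ l : Fin (k + 1),
          (⇑(pderiv (0 : Fin 2)))^[k - (l : ℕ)] ((⇑(pderiv (1 : Fin 2)))^[(l : ℕ)] (A i)) *
          ((-1) ^ (k - (l : ℕ)) * (k.choose l : MvPolynomial (Fin 2) ℂ) *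
            (⇑(pderiv (0 : Fin 2)))^[(l : ℕ)] ((⇑(pderiv (1 : Fin 2)))^[k - (l : ℕ)] B))) *
        Matrix.det (Matrix.of fun (p q : Fin k) =>
          a * X 0 * (⇑(pderiv (0 : Fin 2)))^[k - (q.castSucc : ℕ)]
            ((⇑(pderiv (1 : Fin 2)))^[(q.castSucc : ℕ)] (A (i.succAbove p))) +
          a * X 1 * (⇑(pderiv (0 : Fin 2)))^[k - (q.succ : ℕ)]
            ((⇑(pderiv (1 : Fin 2)))^[(q.succ : ℕ)] (A (i.succAbove p)))) := by
        rw [gammaTransvectant, Finset.mul_sum]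
        refine Finset.sum_congr rfl fun i _ => ?_
        rw [transvectant_eq_sum_fin, wronskian_removeIdx hrd hA, ← C_mul']
        simp only [map_pow C (-1 : ℂ), map_neg, map_one]
        ring
    _ = _ := by
        rw [key, wronskian, ← hconst, ← C_mul', ← C_mul', ha]
        simp only [map_mul, map_pow, map_neg, map_one, map_natCast, Nat.add_sub_cancel]
        ring
end

section
/- Let d, r be integers with 2 ≤ r ≤ d−1. Let A₁,…,A_r be linearly independent binary forms of order d over ℂ, and let (C_q)_{q∈𝒩_r} be a Wronskian-combinant collection for (A₁,…,A_r). Suppose (E_q)_{q∈𝒩_r} is a family of binary forms with E_q of order r(d−r+1)−2q, satisfying Σ_{q∈𝒩_r} (E_q, A_i)_{r−q} = 0 for every i = 1,…,r. Then there exists a constant k ∈ ℂ such that E_q = k·C_q for all q ∈ 𝒩_r; moreover, if not all the E_q are zero, then k ≠ 0. -/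
open MvPolynomial Finset

theorem coeff_eq_zero_of_sum_mul_iterate_derivative_eq_zero {s : ℕ} {a : Fin s → Polynomial ℂ}
    (ha : LinearIndependent ℂ a) {c : ℕ → Polynomial ℂ}
    (h : ∀ i, ∑ j ∈ range s, c j * Polynomial.derivative^[j] (a i) = 0) :
    ∀ j < s, c j = 0 := by
  by_contra! hne
  obtain ⟨m, ⟨hms, hm⟩, hmax⟩ : ∃ m, (m < s ∧ c m ≠ 0) ∧ ∀ j, m < j → j < s → c j = 0 := by
    classical
    obtain ⟨j, hj⟩ := hne
    obtain ⟨m, hm, hmax⟩ := ((range s).filter fun j => c j ≠ 0).exists_max_image id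
      ⟨j, by simpa using hj⟩
    refine ⟨m, by simpa using hm, fun j hmj hjs => ?_⟩
    by_contra hcj
    exact absurd (hmax j (by simpa using ⟨hjs, hcj⟩)) (by simpa using hmj)
  obtain ⟨t, ht⟩ : ∃ t, (c m).eval t ≠ 0 := by
    by_contra! hz
    exact hm (Polynomial.funext (by simpa using hz))
  let φ : (Fin s → ℂ) →ₗ[ℂ] Fin m → ℂ := LinearMap.pi fun j =>
    Polynomial.leval t ∘ₗ (Polynomial.derivative ^ (j : ℕ)) ∘ₗ Fintype.linearCombination ℂ a
  obtain ⟨v, hv, hv0⟩ := (Submodule.ne_bot_iff _).1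
    (LinearMap.ker_ne_bot_of_finrank_lt (f := φ) (by simpa using hms))
  set f := Fintype.linearCombination ℂ a v with hf
  have hf0 : f ≠ 0 := fun h0 => hv0 <| by
    have := Fintype.linearIndependent_iff.1 ha v (by simpa [hf, Fintype.linearCombination_apply] using h0)
    exact funext this
  have hroot : ∀ j < m, (Polynomial.derivative^[j] f).IsRoot t := fun j hj => by
    have := congrFun (LinearMap.mem_ker.1 hv) ⟨j, hj⟩
    simpa [φ, Polynomial.IsRoot, Module.End.pow_apply] using this
  have hode : ∑ j ∈ range s, c j * Polynomial.derivative^[j] f = 0 := by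
    simp only [hf, Fintype.linearCombination_apply, Polynomial.iterate_derivative_sum,
      Polynomial.iterate_derivative_smul, mul_sum, mul_smul_comm]
    rw [sum_comm]
    simp only [← smul_sum, h, smul_zero, sum_const_zero]
  set n := f.rootMultiplicity t with hn
  have hmn : m ≤ n := by
    rcases Nat.eq_zero_or_pos m with rfl | hpos
    · exact Nat.zero_le _
    · have := Polynomial.lt_rootMultiplicity_of_isRoot_iterate_derivative (n := m - 1) hf0
        (fun j hj => hroot j (by omega))
      omega
  have hdvd : ∀ j < m, (Polynomial.X - Polynomial.C t) ^ (n - m + 1) ∣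
      Polynomial.derivative^[j] f := fun j hj =>
    (pow_dvd_pow _ (by omega)).trans
      (Polynomial.pow_sub_dvd_iterate_derivative_of_pow_dvd j (f.pow_rootMultiplicity_dvd t))
  have hcm : (Polynomial.X - Polynomial.C t) ^ (n - m + 1) ∣
      c m * Polynomial.derivative^[m] f := by
    rw [← add_sum_erase _ _ (mem_range.2 hms)] at hode
    rw [eq_neg_of_add_eq_zero_left hode, dvd_neg]
    refine dvd_sum fun j hj => ?_
    rw [mem_erase, mem_range] at hj
    rcases lt_or_gt_of_ne hj.1 with hlt | hgt
    · exact (hdvd j hlt).mul_left _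
    · simp [hmax j hgt hj.2]
  have hDm := (Polynomial.prime_X_sub_C t).pow_dvd_of_dvd_mul_left _
    (by rwa [Polynomial.dvd_iff_isRoot]) hcm
  have hDn := Polynomial.pow_sub_dvd_iterate_derivative_of_pow_dvd (n - m) hDm
  rw [← Function.iterate_add_apply, Nat.sub_add_cancel hmn, Nat.add_sub_cancel_left, pow_one,
    Polynomial.dvd_iff_isRoot] at hDn
  refine lt_irrefl n (Polynomial.lt_rootMultiplicity_of_isRoot_iterate_derivative hf0 fun j hj => ?_)
  rcases hj.lt_or_eq with hlt | rfl
  · rw [← Polynomial.dvd_iff_isRoot]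
    exact (dvd_pow_self _ (by omega)).trans
      (Polynomial.pow_sub_dvd_iterate_derivative_of_pow_dvd j (f.pow_rootMultiplicity_dvd t))
  · exact hDn

/-- Dehomogenization of binary polynomials, setting the second variable to `1`. -/
noncomputable def dehomogenize : MvPolynomial (Fin 2) ℂ →ₐ[ℂ] Polynomial ℂ :=
  aeval ![Polynomial.X, 1]

theorem dehomogenize_pderiv_zero (F : MvPolynomial (Fin 2) ℂ) :
    dehomogenize (pderiv 0 F) = Polynomial.derivative (dehomogenize F) := by
  induction F using MvPolynomial.induction_on with
  | C a => simp [dehomogenize]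
  | add p q hp hq => simp [hp, hq]
  | mul_X p i hp =>
    fin_cases i <;> simp [dehomogenize, pderiv_X, Derivation.leibniz] at hp ⊢ <;> simp [hp]
    ring

theorem dehomogenize_pderiv_zero_iterate (j : ℕ) (F : MvPolynomial (Fin 2) ℂ) :
    dehomogenize ((pderiv 0)^[j] F) = Polynomial.derivative^[j] (dehomogenize F) := by
  induction j generalizing F with
  | zero => rfl
  | succ j ih => simp [ih, dehomogenize_pderiv_zero]

theorem dehomogenize_pderiv_one {n : ℕ} {F : MvPolynomial (Fin 2) ℂ} (hF : F.IsHomogeneous n) :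
    dehomogenize (pderiv 1 F) =
      (n : ℂ) • dehomogenize F - Polynomial.X * Polynomial.derivative (dehomogenize F) := by
  have h := congrArg dehomogenize hF.sum_X_mul_pderiv
  rw [Fin.sum_univ_two, map_add, map_mul, map_mul, dehomogenize_pderiv_zero, map_nsmul] at h
  simp only [dehomogenize, aeval_X, Matrix.cons_val_zero, Matrix.cons_val_one, one_mul] at h ⊢
  rw [Nat.cast_smul_eq_nsmul, ← h]
  ring

theorem coeff_dehomogenize {n : ℕ} {F : MvPolynomial (Fin 2) ℂ} (hF : F.IsHomogeneous n)
    {s : Fin 2 →₀ ℕ} (hs : s.degree = n) : (dehomogenize F).coeff (s 0) = F.coeff s := by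
  rw [dehomogenize, aeval_def, eval₂_eq', Polynomial.finsetSum_coeff]
  simp only [Fin.prod_univ_two, Matrix.cons_val_zero, Matrix.cons_val_one, one_pow, mul_one,
    Polynomial.algebraMap_eq, Polynomial.coeff_C_mul, Polynomial.coeff_X_pow, mul_ite, mul_zero]
  rw [sum_eq_single s]
  · simp
  · intro u hu hus
    refine if_neg fun h => hus ?_
    have hu' : u.degree = n := by
      by_contra hne
      exact (mem_support_iff.1 hu) (hF.coeff_eq_zero hne)
    rw [Finsupp.degree_eq_sum, Fin.sum_univ_two] at hs hu'
    ext i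
    fin_cases i <;> simp <;> omega
  · intro hs'
    simp [notMem_support_iff.1 hs']

theorem eq_zero_of_dehomogenize_eq_zero {n : ℕ} {F : MvPolynomial (Fin 2) ℂ}
    (hF : F.IsHomogeneous n) (h : dehomogenize F = 0) : F = 0 := by
  ext s
  by_cases hs : s.degree = n
  · rw [← coeff_dehomogenize hF hs, h]
    simp
  · rw [hF.coeff_eq_zero hs, coeff_zero]

theorem pderiv_pderiv_comm (i j : Fin 2) (F : MvPolynomial (Fin 2) ℂ) :
    pderiv i (pderiv j F) = pderiv j (pderiv i F) := by
  induction F using MvPolynomial.induction_on with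
  | C a => simp
  | add p q hp hq => simp [hp, hq]
  | mul_X p k hp =>
    simp only [Derivation.leibniz, pderiv_X, smul_eq_mul, map_add, hp, Pi.single_apply]
    split_ifs <;> simp <;> ring

/-- The operator `Ω^k = (∂₁ ⊗ ∂₂ - ∂₂ ⊗ ∂₁)^k` followed by multiplication. -/
noncomputable def omegaPow : ℕ → MvPolynomial (Fin 2) ℂ → MvPolynomial (Fin 2) ℂ →
    MvPolynomial (Fin 2) ℂ
  | 0, E, F => E * F
  | k + 1, E, F => omegaPow k (pderiv 0 E) (pderiv 1 F) - omegaPow k (pderiv 1 E) (pderiv 0 F)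

theorem pderiv_iterate_comm (i j : Fin 2) (n : ℕ) (F : MvPolynomial (Fin 2) ℂ) :
    pderiv i ((pderiv j)^[n] F) = (pderiv j)^[n] (pderiv i F) :=
  (Function.Commute.iterate_right (pderiv_pderiv_comm i j) n) F

theorem omegaPow_eq_sum_antidiagonal (k : ℕ) (E F : MvPolynomial (Fin 2) ℂ) :
    omegaPow k E F = ∑ ij ∈ antidiagonal k, (k.choose ij.1 : MvPolynomial (Fin 2) ℂ) *
      ((-1) ^ ij.1 * ((pderiv 0)^[ij.2] ((pderiv 1)^[ij.1] E) *
        (pderiv 0)^[ij.1] ((pderiv 1)^[ij.2] F))) := by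
  induction k generalizing E F with
  | zero => simp [omegaPow]
  | succ k ih =>
    rw [sum_antidiagonal_choose_succ_mul (fun i j => (-1 : MvPolynomial (Fin 2) ℂ) ^ i *
      ((pderiv 0)^[j] ((pderiv 1)^[i] E) * (pderiv 0)^[i] ((pderiv 1)^[j] F))), omegaPow, ih, ih,
      sub_eq_add_neg, ← sum_neg_distrib]
    refine congr (congrArg HAdd.hAdd ?_) ?_
    · refine sum_congr rfl fun ij _ => ?_
      rw [Function.iterate_succ_apply, Function.iterate_succ_apply, pderiv_iterate_comm 0 1]
    · refine sum_congr rfl fun ij hij => ?_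
      rw [HasAntidiagonal.mem_antidiagonal] at hij
      rw [Nat.choose_symm_of_eq_add hij.symm]
      rw [Function.iterate_succ_apply, Function.iterate_succ_apply, pderiv_iterate_comm 0 1]
      ring

theorem transvectant_eq_smul_omegaPow (e f k : ℕ) (E F : MvPolynomial (Fin 2) ℂ) :
    transvectant e f k E F = ((((e - k).factorial * (f - k).factorial : ℕ) : ℂ) /
      ((e.factorial * f.factorial : ℕ) : ℂ)) • omegaPow k E F := by
  rw [transvectant, omegaPow_eq_sum_antidiagonal, Nat.sum_antidiagonal_eq_sum_range_succ
    (fun i j => (k.choose i : MvPolynomial (Fin 2) ℂ) * ((-1) ^ i *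
      ((pderiv 0)^[j] ((pderiv 1)^[i] E) * (pderiv 0)^[i] ((pderiv 1)^[j] F))))]
  congr 1
  refine sum_congr rfl fun i _ => ?_
  rw [smul_eq_C_mul]
  simp only [map_mul, map_pow, map_neg, map_one, map_natCast]
  ring

theorem iterate_derivative_smul_sub_X_mul_derivative (c : ℂ) (i : ℕ) (f : Polynomial ℂ) :
    Polynomial.derivative^[i] (c • f - Polynomial.X * Polynomial.derivative f) =
      (c - i) • Polynomial.derivative^[i] f -
        Polynomial.X * Polynomial.derivative^[i + 1] f := by
  induction i with
  | zero => simp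
  | succ i ih =>
    rw [Function.iterate_succ_apply', ih]
    rw [Polynomial.derivative_sub, Polynomial.derivative_smul, Polynomial.derivative_mul,
      Polynomial.derivative_X, one_mul, ← Function.iterate_succ_apply' Polynomial.derivative,
      ← Function.iterate_succ_apply' Polynomial.derivative]
    simp only [Polynomial.smul_eq_C_mul, map_sub, Nat.succ_eq_add_one, Nat.cast_succ, map_add,
      map_one]
    ring

theorem exists_dehomogenize_omegaPow (k m n : ℕ) (hm : k ≤ m) (hn : k ≤ n) :
    ∃ p : ℕ → ℕ, (∀ i ≤ k, 0 < p i) ∧ ∀ E F : MvPolynomial (Fin 2) ℂ,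
      E.IsHomogeneous m → F.IsHomogeneous n → dehomogenize (omegaPow k E F) =
        ∑ i ∈ range (k + 1), ((-1) ^ i * (p i : ℂ)) •
          (Polynomial.derivative^[k - i] (dehomogenize E) *
            Polynomial.derivative^[i] (dehomogenize F)) := by
  induction k generalizing m n with
  | zero => exact ⟨fun _ => 1, by simp, by simp [omegaPow]⟩
  | succ k ih =>
    obtain ⟨p, hp, h⟩ := ih (m - 1) (n - 1) (by omega) (by omega)
    refine ⟨fun i => (if i = k + 1 then 0 else (n - i) * p i) +
      (if i = 0 then 0 else (m - (k - (i - 1))) * p (i - 1)), fun i hi => ?_, fun E F hE hF => ?_⟩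
    · by_cases hik : i = k + 1
      · subst hik
        have := hp k le_rfl
        have : 0 < m := by omega
        simp only [if_true, Nat.succ_ne_zero, if_false, Nat.add_sub_cancel, Nat.sub_self, zero_add,
          Nat.sub_zero]
        positivity
      · have := hp i (by omega)
        have : 0 < n - i := by omega
        simp only [if_neg hik]
        positivity
    · rw [omegaPow, map_sub, h _ _ hE.pderiv hF.pderiv, h _ _ hE.pderiv hF.pderiv]
      simp only [Nat.cast_add, mul_add, add_smul, sum_add_distrib]
      rw [sum_range_succ _ (k + 1), sum_range_succ' _ (k + 1)]
      simp only [if_true, Nat.cast_zero, mul_zero, zero_smul, add_zero, Nat.add_sub_cancel,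
        if_neg (Nat.succ_ne_zero _), ← sum_sub_distrib, ← sum_add_distrib]
      refine sum_congr rfl fun i hi => ?_
      have hi : i ≤ k := Nat.lt_succ_iff.1 (mem_range.1 hi)
      rw [if_neg (by omega : i ≠ k + 1), dehomogenize_pderiv_zero, dehomogenize_pderiv_zero,
        dehomogenize_pderiv_one hE, dehomogenize_pderiv_one hF,
        iterate_derivative_smul_sub_X_mul_derivative, iterate_derivative_smul_sub_X_mul_derivative,
        ← Function.iterate_succ_apply, ← Function.iterate_succ_apply, Nat.add_sub_add_right,
        Nat.succ_eq_add_one, Nat.succ_eq_add_one, Nat.sub_add_comm hi]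
      simp only [Polynomial.smul_eq_C_mul, map_mul, map_pow, map_neg, map_one, map_sub, map_natCast,
        Nat.cast_mul, Nat.cast_sub (by omega : i ≤ n), Nat.cast_sub (by omega : k - i ≤ m),
        Nat.cast_sub hi, pow_succ]
      ring

theorem exists_dehomogenize_pderiv (d a j : ℕ) (h : a + j ≤ d) :
    ∃ u : ℕ → Polynomial ℂ, u 0 ≠ 0 ∧ ∀ F : MvPolynomial (Fin 2) ℂ, F.IsHomogeneous d →
      dehomogenize ((pderiv 0)^[a] ((pderiv 1)^[j] F)) =
        ∑ l ∈ range (j + 1), u l * Polynomial.derivative^[a + l] (dehomogenize F) := by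
  induction j generalizing d a with
  | zero =>
    exact ⟨fun _ => 1, one_ne_zero, fun F _ => by simp [dehomogenize_pderiv_zero_iterate]⟩
  | succ j ih =>
    obtain ⟨u, hu, h1⟩ := ih (d - 1) a (by omega)
    have hda : ((d : ℂ) - a) ≠ 0 := by
      rw [sub_ne_zero]
      exact_mod_cast (by omega : d ≠ a)
    refine ⟨fun l => (if l = j + 1 then 0 else ((d : ℂ) - (a + l : ℕ)) • u l) -
      (if l = 0 then 0 else Polynomial.X * u (l - 1)), ?_, fun F hF => ?_⟩
    · simpa using ⟨hda, hu⟩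
    · rw [Function.iterate_succ_apply, h1 _ hF.pderiv, dehomogenize_pderiv_one hF]
      simp only [sub_mul, sum_sub_distrib]
      rw [sum_range_succ _ (j + 1), sum_range_succ' _ (j + 1)]
      simp only [if_true, zero_mul, add_zero, Nat.add_sub_cancel, if_neg (Nat.succ_ne_zero _),
        ← sum_sub_distrib]
      refine sum_congr rfl fun l hl => ?_
      have hl := mem_range.1 hl
      rw [if_neg (by omega : l ≠ j + 1), iterate_derivative_smul_sub_X_mul_derivative]
      simp only [Polynomial.smul_eq_C_mul, ← add_assoc]
      ring

theorem linearIndependent_dehomogenize {d s : ℕ} {B : Fin s → MvPolynomial (Fin 2) ℂ}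
    (hB : ∀ i, (B i).IsHomogeneous d) (hind : LinearIndependent ℂ B) :
    LinearIndependent ℂ fun i => dehomogenize (B i) := by
  rw [Fintype.linearIndependent_iff] at hind ⊢
  refine fun g hg => hind g (eq_zero_of_dehomogenize_eq_zero (n := d) ?_ ?_)
  · exact (homogeneousSubmodule (Fin 2) ℂ d).sum_mem fun i _ => Submodule.smul_mem _ _ (hB i)
  · simpa [map_sum, map_smul] using hg

theorem det_iterate_derivative_ne_zero {s : ℕ} {b : Fin s → Polynomial ℂ}
    (hb : LinearIndependent ℂ b) :
    (Matrix.of fun i j : Fin s => Polynomial.derivative^[s - 1 - (j : ℕ)] (b i)).det ≠ 0 := by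
  intro h
  obtain ⟨v, hv, hv0⟩ := Matrix.exists_mulVec_eq_zero_iff.2 h
  refine hv (funext fun j => ?_)
  have := coeff_eq_zero_of_sum_mul_iterate_derivative_eq_zero hb
    (c := fun j => if h : j < s then v (Fin.rev ⟨j, h⟩) else 0) (fun i => ?_) _ (Fin.rev j).isLt
  · simpa only [(Fin.rev j).isLt, dif_pos, Fin.eta, Fin.rev_rev, Pi.zero_apply] using this
  · have hi := congrFun hv0 i
    rw [Matrix.mulVec, dotProduct, ← Equiv.sum_comp Fin.revPerm] at hi
    rw [sum_range, ← Pi.zero_apply (M := fun _ => Polynomial ℂ) i, ← hi]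
    refine sum_congr rfl fun j _ => ?_
    have : s - 1 - (s - (j + 1)) = (j : ℕ) := by omega
    simp [Fin.val_rev, this, mul_comm]

theorem dehomogenize_wronskian_ne_zero {d s : ℕ} (hs : s ≤ d + 1)
    {B : Fin s → MvPolynomial (Fin 2) ℂ} (hB : ∀ i, (B i).IsHomogeneous d)
    (hind : LinearIndependent ℂ B) : dehomogenize (wronskian d B) ≠ 0 := by
  choose u hu hB' using fun j : Fin s => exists_dehomogenize_pderiv d (s - 1 - j) j (by omega)
  set U : Matrix (Fin s) (Fin s) (Polynomial ℂ) :=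
    Matrix.of fun m j => if m ≤ j then u j (j - m) else 0 with hU
  have hUdet : U.det ≠ 0 := by
    rw [Matrix.det_of_isUpperTriangular]
    · exact prod_ne_zero_iff.2 fun i _ => by simpa [hU] using hu i
    · intro i j hij
      exact if_neg (not_le.2 hij)
  have hM : (dehomogenize : _ →+* Polynomial ℂ).mapMatrix (Matrix.of fun i j : Fin s =>
      (pderiv 0)^[s - 1 - (j : ℕ)] ((pderiv 1)^[(j : ℕ)] (B i))) =
      (Matrix.of fun i j : Fin s =>
        Polynomial.derivative^[s - 1 - (j : ℕ)] (dehomogenize (B i))) * U := by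
    ext1 i j
    rw [Matrix.mul_apply]
    simp only [RingHom.mapMatrix_apply, Matrix.map_apply, Matrix.of_apply, hU, RingHom.coe_coe,
      hB' j _ (hB i), Fin.le_def]
    rw [← sum_range_reflect, ← sum_range fun m => Polynomial.derivative^[s - 1 - m]
      (dehomogenize (B i)) * if m ≤ (j : ℕ) then u j (j - m) else 0]
    refine (sum_congr rfl fun m hm => ?_).trans
      (sum_subset (range_subset_range.2 j.isLt) fun m _ hm => ?_)
    · have hm := mem_range.1 hm
      rw [if_pos (by omega), mul_comm]
      congr 2
      omega
    · rw [mem_range] at hm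
      rw [if_neg (by omega), mul_zero]
  rw [wronskian, map_smul]
  refine smul_ne_zero (pow_ne_zero _ (div_ne_zero ?_ ?_)) fun h => ?_
  · exact_mod_cast Nat.factorial_ne_zero _
  · exact_mod_cast Nat.factorial_ne_zero _
  · rw [← RingHom.coe_coe, RingHom.map_det, hM, Matrix.det_mul] at h
    exact mul_ne_zero (det_iterate_derivative_ne_zero (linearIndependent_dehomogenize hB hind))
      hUdet h

theorem exists_isHomogeneous_notMem_span {d r : ℕ} (h : r ≤ d)
    (A : Fin r → MvPolynomial (Fin 2) ℂ) :
    ∃ F : MvPolynomial (Fin 2) ℂ, F.IsHomogeneous d ∧ F ∉ Submodule.span ℂ (Set.range A) := by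
  by_contra! hF
  let M : Fin (d + 1) → MvPolynomial (Fin 2) ℂ := fun j => X 0 ^ (j : ℕ) * X 1 ^ (d - j)
  have hM : LinearIndependent ℂ M := by
    refine LinearIndependent.of_comp dehomogenize.toLinearMap ?_
    have : ⇑dehomogenize.toLinearMap ∘ M =
        Polynomial.basisMonomials ℂ ∘ fun j : Fin (d + 1) => (j : ℕ) := by
      ext1 j
      simp [M, dehomogenize, Polynomial.X_pow_eq_monomial]
    rw [this]
    exact (Polynomial.basisMonomials ℂ).linearIndependent.comp _ Fin.val_injective
  have hspan : Set.range M ≤ Submodule.span ℂ (Set.range A) := by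
    rintro _ ⟨j, rfl⟩
    refine hF _ ?_
    convert (isHomogeneous_X_pow (R := ℂ) (0 : Fin 2) (j : ℕ)).mul
      (isHomogeneous_X_pow (1 : Fin 2) (d - j))
    omega
  classical
  have := linearIndependent_le_span_aux' M hM _ hspan
  have := Fintype.card_range_le A
  simp at *
  omega

theorem eq_smul_of_mul_derivative_eq {e c : Polynomial ℂ} (hc : c ≠ 0)
    (h : c * Polynomial.derivative e = e * Polynomial.derivative c) : ∃ k : ℂ, e = k • c := by
  have hdep : ¬ LinearIndependent ℂ ![c, e] := fun hind => by
    refine hc (coeff_eq_zero_of_sum_mul_iterate_derivative_eq_zero hind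
      (c := ![-Polynomial.derivative c, c] ∘ Fin.ofNat 2) (fun i => ?_) 1 one_lt_two)
    fin_cases i
    · simp [sum_range_succ]
      ring
    · simp [sum_range_succ]
      linear_combination h
  rw [LinearIndependent.pair_iff' hc] at hdep
  push Not at hdep
  obtain ⟨k, hk⟩ := hdep
  exact ⟨k, hk.symm⟩

theorem exists_dehomogenize_transvectant (m n k : ℕ) (hm : k ≤ m) (hn : k ≤ n) :
    ∃ w : ℕ → ℂ, (∀ i ≤ k, w i ≠ 0) ∧ ∀ E F : MvPolynomial (Fin 2) ℂ,
      E.IsHomogeneous m → F.IsHomogeneous n → dehomogenize (transvectant m n k E F) =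
        ∑ i ∈ range (k + 1), w i • (Polynomial.derivative^[k - i] (dehomogenize E) *
            Polynomial.derivative^[i] (dehomogenize F)) := by
  obtain ⟨p, hp, h⟩ := exists_dehomogenize_omegaPow k m n hm hn
  refine ⟨fun i => ((((m - k).factorial * (n - k).factorial : ℕ) : ℂ) /
    ((m.factorial * n.factorial : ℕ) : ℂ)) * ((-1) ^ i * (p i : ℂ)), fun i hi => ?_,
    fun E F hE hF => ?_⟩
  · have : (p i : ℂ) ≠ 0 := by exact_mod_cast (hp i hi).ne'
    refine mul_ne_zero (div_ne_zero ?_ ?_) (mul_ne_zero (by simp) this) <;>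
      exact_mod_cast mul_ne_zero (Nat.factorial_ne_zero _) (Nat.factorial_ne_zero _)
  · rw [transvectant_eq_smul_omegaPow, map_smul, h E F hE hF, smul_sum]
    simp only [smul_smul]

/-- The coefficient of the `j`-th derivative in the differential operator
`f ↦ ∑ q ∈ Nset r, ∑ i ≤ r - q, w q i • (e q)^(r - q - i) * f^(i)`. -/
noncomputable def operatorCoeff (r : ℕ) (w : ℕ → ℕ → ℂ) (e : ℕ → Polynomial ℂ) (j : ℕ) :
    Polynomial ℂ :=
  ∑ q ∈ Nset r with q + j ≤ r, w q j • Polynomial.derivative^[r - q - j] (e q)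

theorem sum_operatorCoeff_mul (r : ℕ) (w : ℕ → ℕ → ℂ) (e : ℕ → Polynomial ℂ)
    (f : Polynomial ℂ) :
    ∑ j ∈ range (r + 1), operatorCoeff r w e j * Polynomial.derivative^[j] f =
      ∑ q ∈ Nset r, ∑ i ∈ range (r - q + 1), w q i •
        (Polynomial.derivative^[r - q - i] (e q) * Polynomial.derivative^[i] f) := by
  simp only [operatorCoeff, sum_mul, smul_mul_assoc]
  refine sum_comm' fun j q => ?_
  simp only [mem_range, mem_filter, Nset]
  omega

theorem operatorCoeff_sub_smul (r : ℕ) (w : ℕ → ℕ → ℂ) (e c : ℕ → Polynomial ℂ) (k : ℂ) (j : ℕ) :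
    operatorCoeff r w (fun q => e q - k • c q) j =
      operatorCoeff r w e j - k • operatorCoeff r w c j := by
  simp only [operatorCoeff, smul_sum, ← sum_sub_distrib, Polynomial.iterate_derivative_sub,
    Polynomial.iterate_derivative_smul, smul_sub, smul_comm k]

theorem operatorCoeff_self (r : ℕ) (w : ℕ → ℕ → ℂ) (e : ℕ → Polynomial ℂ) :
    operatorCoeff r w e r = w 0 r • e 0 := by
  have : {q ∈ Nset r | q + r ≤ r} = {0} := by
    ext q
    simp only [Nset, mem_filter, mem_range, mem_singleton]
    omega
  rw [operatorCoeff, this, sum_singleton]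
  simp

theorem operatorCoeff_sub_one {r : ℕ} (hr : 2 ≤ r) (w : ℕ → ℕ → ℂ) (e : ℕ → Polynomial ℂ) :
    operatorCoeff r w e (r - 1) = w 0 (r - 1) • Polynomial.derivative (e 0) := by
  have : {q ∈ Nset r | q + (r - 1) ≤ r} = {0} := by
    ext q
    simp only [Nset, mem_filter, mem_range, mem_singleton]
    omega
  rw [operatorCoeff, this, sum_singleton, Nat.sub_zero, Nat.sub_sub_self (by omega)]
  rfl

theorem eq_zero_of_operatorCoeff_eq_zero {r : ℕ} {w : ℕ → ℕ → ℂ}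
    (hw : ∀ q ∈ Nset r, w q (r - q) ≠ 0) {e : ℕ → Polynomial ℂ}
    (h : ∀ j ≤ r, operatorCoeff r w e j = 0) : ∀ q ∈ Nset r, e q = 0 := by
  intro q
  induction q using Nat.strong_induction_on with
  | _ q ih =>
    intro hq
    have hqr : q ≤ r := by
      simp only [Nset, mem_filter, mem_range] at hq
      omega
    have h0 := h (r - q) (Nat.sub_le _ _)
    rw [operatorCoeff, sum_eq_single_of_mem q (by simp [hq, hqr])] at h0
    · simpa [hw q hq] using h0
    · intro q' hq' hne
      rw [mem_filter] at hq'
      simp [ih q' (by omega) hq'.1]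

/-- if `A₁,...,A_r` are linearly independent binary forms of order `d`
with Wronskian-combinant collection `(C_q)`, and `(E_q)` is a family of forms of
order `r(d-r+1)-2q` with `Σ_q (E_q, A_i)_(r-q) = 0` for every `i`, then `E_q = k • C_q`
for some constant `k`, which is nonzero if not all the `E_q` vanish. -/
theorem eq_smul_combinants_of_solutions (d r : ℕ) (hr2 : 2 ≤ r) (hrd : r ≤ d - 1)
    (A : Fin r → MvPolynomial (Fin 2) ℂ) (hA : ∀ i, (A i).IsHomogeneous d)
    (hind : LinearIndependent ℂ A)
    (C : ℕ → MvPolynomial (Fin 2) ℂ) (hC : IsWronskianCombinantCollection d r A C)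
    (E : ℕ → MvPolynomial (Fin 2) ℂ)
    (hE : ∀ q ∈ Nset r, (E q).IsHomogeneous (r * (d - r + 1) - 2 * q))
    (heq : ∀ i, ∑ q ∈ Nset r,
      transvectant (r * (d - r + 1) - 2 * q) d (r - q) (E q) (A i) = 0) :
    ∃ k : ℂ, (∀ q ∈ Nset r, E q = k • C q) ∧ ((∃ q ∈ Nset r, E q ≠ 0) → k ≠ 0) := by
  have hN : ∀ q ∈ Nset r, q ≤ r := fun q hq => by
    simp only [Nset, mem_filter, mem_range] at hq
    omega
  have hN0 : 0 ∈ Nset r := by simp [Nset]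
  have hord : ∀ q, q ≤ r → r - q ≤ r * (d - r + 1) - 2 * q := fun q hq => by
    have : r * 2 ≤ r * (d - r + 1) := Nat.mul_le_mul_left r (by omega)
    omega
  have htv : ∀ q, ∃ w : ℕ → ℂ, q ∈ Nset r → (∀ i ≤ r - q, w i ≠ 0) ∧
      ∀ G F : MvPolynomial (Fin 2) ℂ, G.IsHomogeneous (r * (d - r + 1) - 2 * q) →
        F.IsHomogeneous d →
        dehomogenize (transvectant (r * (d - r + 1) - 2 * q) d (r - q) G F) =
          ∑ i ∈ range (r - q + 1), w i • (Polynomial.derivative^[r - q - i] (dehomogenize G) *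
            Polynomial.derivative^[i] (dehomogenize F)) := fun q => by
    by_cases hq : q ∈ Nset r
    · obtain ⟨w, hw⟩ := exists_dehomogenize_transvectant _ d (r - q) (hord q (hN q hq)) (by omega)
      exact ⟨w, fun _ => hw⟩
    · exact ⟨0, fun h => absurd h hq⟩
  choose w hw using htv
  have hop : ∀ G : ℕ → MvPolynomial (Fin 2) ℂ,
      (∀ q ∈ Nset r, (G q).IsHomogeneous (r * (d - r + 1) - 2 * q)) →
      ∀ F : MvPolynomial (Fin 2) ℂ, F.IsHomogeneous d →
      ∑ j ∈ range (r + 1), operatorCoeff r w (fun q => dehomogenize (G q)) j *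
        Polynomial.derivative^[j] (dehomogenize F) =
      dehomogenize (∑ q ∈ Nset r,
        transvectant (r * (d - r + 1) - 2 * q) d (r - q) (G q) F) := fun G hG F hF => by
    rw [sum_operatorCoeff_mul, map_sum]
    exact sum_congr rfl fun q hq => ((hw q hq).2 _ _ (hG q hq) hF).symm
  set ε := operatorCoeff r w fun q => dehomogenize (E q) with hε
  set γ := operatorCoeff r w fun q => dehomogenize (C q) with hγ
  have hind' := linearIndependent_dehomogenize hA hind
  have hEA : ∀ i, ∑ j ∈ range (r + 1), ε j * Polynomial.derivative^[j] (dehomogenize (A i)) = 0 :=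
    fun i => by rw [hop E hE _ (hA i), heq, map_zero]
  have hCA : ∀ i, ∑ j ∈ range (r + 1), γ j * Polynomial.derivative^[j] (dehomogenize (A i)) = 0 :=
    fun i => by
      rw [hop C hC.1 _ (hA i), ← hC.2 _ (hA i), wronskian,
        Matrix.det_zero_of_row_eq (i := i.castSucc) (j := Fin.last r) (Fin.castSucc_lt_last i).ne]
      · simp
      · ext1 j
        simp
  have hγr : γ r ≠ 0 := fun h0 => by
    have hγ0 := coeff_eq_zero_of_sum_mul_iterate_derivative_eq_zero hind' (c := γ)
      fun i => by simpa [sum_range_succ, h0] using hCA i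
    obtain ⟨F, hF, hFA⟩ := exists_isHomogeneous_notMem_span (by omega : r ≤ d) A
    have hB : ∀ i, ((Fin.snoc A F : Fin (r + 1) → MvPolynomial (Fin 2) ℂ) i).IsHomogeneous d :=
      fun i => by
        induction i using Fin.lastCases with
        | last => simpa using hF
        | cast i => simpa using hA i
    refine dehomogenize_wronskian_ne_zero (by omega) hB
      (linearIndependent_finSnoc.2 ⟨hind, hFA⟩) ?_
    rw [hC.2 F hF, ← hop C hC.1 F hF, sum_range_succ, ← hγ, h0, zero_mul, add_zero]
    exact sum_eq_zero fun j hj => by rw [hγ0 j (mem_range.1 hj), zero_mul]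
  have hprop : ∀ j ≤ r, γ r * ε j = ε r * γ j := fun j hj => by
    rcases hj.lt_or_eq with hlt | rfl
    · refine sub_eq_zero.1 (coeff_eq_zero_of_sum_mul_iterate_derivative_eq_zero hind'
        (c := fun j => γ r * ε j - ε r * γ j) (fun i => ?_) j hlt)
      have h1 := hEA i
      have h2 := hCA i
      rw [sum_range_succ] at h1 h2
      simp only [sub_mul, mul_assoc, sum_sub_distrib, ← mul_sum]
      linear_combination γ r * h1 - ε r * h2
    · exact mul_comm _ _
  obtain ⟨k, hk⟩ : ∃ k : ℂ, dehomogenize (E 0) = k • dehomogenize (C 0) := by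
    have hw1 := (hw 0 hN0).1 r (by omega)
    have hw2 := (hw 0 hN0).1 (r - 1) (by omega)
    have h := hprop (r - 1) (by omega)
    simp only [hε, hγ, operatorCoeff_self, operatorCoeff_sub_one hr2, smul_mul_smul_comm] at h
    rw [hγ, operatorCoeff_self] at hγr
    exact eq_smul_of_mul_derivative_eq (right_ne_zero_of_smul hγr)
      (smul_right_injective _ (mul_ne_zero hw1 hw2) h)
  have hεr : ε r = k • γ r := by
    simp only [hε, hγ, operatorCoeff_self, hk, smul_comm k]
  have hEC := eq_zero_of_operatorCoeff_eq_zero (w := w)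
    (e := fun q => dehomogenize (E q) - k • dehomogenize (C q))
    (fun q hq => (hw q hq).1 _ le_rfl) fun j hj => by
      rw [operatorCoeff_sub_smul, ← hε, ← hγ]
      refine (mul_eq_zero.1 (?_ : γ r * _ = 0)).resolve_left hγr
      rw [mul_sub, hprop j hj, hεr]
      simp
  have hEq : ∀ q ∈ Nset r, E q = k • C q := fun q hq => by
    refine sub_eq_zero.1 (eq_zero_of_dehomogenize_eq_zero
      ((hE q hq).sub (Submodule.smul_mem (homogeneousSubmodule _ _ _) k (hC.1 q hq))) ?_)
    rw [map_sub, map_smul]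
    exact hEC q hq
  refine ⟨k, hEq, fun ⟨q, hq, hq0⟩ hk0 => hq0 ?_⟩
  rw [hEq q hq, hk0, zero_smul]
end
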